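/- Let f(x,y) = 4y² + xy − 6x² − 25y³ + 24xy² + 15x²y − 33x³ + y⁴ − 3xy³ + 15x²y² − 19x³y − 26x⁴ + 33y⁵ − 2xy⁴ − 23x²y³ − 30x³y² − 26x⁴y + 31x⁵. Then the hessian curve Z = {(x,y) ∈ ℝ² : Hess(f)(x,y) = 0} is a compact subset of ℝ² and has exactly 8 connected components. -/

import Mathlib

open MvPolynomial

/-- The hessian determinant of a polynomial in two variables over the reals:
`Hess f = f_xx * f_yy - f_xy ^ 2` (with formal partial derivatives). -/
noncomputable def Hess (f : MvPolynomial (Fin 2) ℝ) : MvPolynomial (Fin 2) ℝ :=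
  pderiv 0 (pderiv 0 f) * pderiv 1 (pderiv 1 f) - (pderiv 0 (pderiv 1 f)) ^ 2

/-- The set of connected components of a set `Z ⊆ ℝ × ℝ` (with its subspace
topology), viewed as subsets of `ℝ × ℝ`. -/
def components (Z : Set (ℝ × ℝ)) : Set (Set (ℝ × ℝ)) :=
  {C | ∃ p ∈ Z, C = connectedComponentIn Z p}

/-- The polynomial `f` of the statement. -/
noncomputable def f : MvPolynomial (Fin 2) ℝ :=
  4 * (X 1)^2 + (X 0)*(X 1) - 6 * (X 0)^2 - 25 * (X 1)^3 + 24 * (X 0)*(X 1)^2 + 15 * (X 0)^2*(X 1) - 33 * (X 0)^3 + (X 1)^4 - 3 * (X 0)*(X 1)^3 + 15 * (X 0)^2*(X 1)^2 - 19 * (X 0)^3*(X 1) - 26 * (X 0)^4 + 33 * (X 1)^5 - 2 * (X 0)*(X 1)^4 - 23 * (X 0)^2*(X 1)^3 - 30 * (X 0)^3*(X 1)^2 - 26 * (X 0)^4*(X 1) + 31 * (X 0)^5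

/-- The hessian curve of `f` in `ℝ²`. -/
noncomputable def Z : Set (ℝ × ℝ) := {p | eval ![p.1, p.2] (Hess f) = 0}

namespace HessianCurve

/-- An integer polynomial in `x` and `y`: the `j`-th entry of the `i`-th row is the coefficient of
`x ^ i * y ^ j`. -/
abbrev BiPoly : Type := List (List ℤ)

/-- The rectangle with centre `(x, y)`, half-width `r` and half-height `s`. -/
structure Box where
  x : ℤ
  y : ℤ
  r : ℕ
  s : ℕ

namespace UniPoly

/-- `p + h * q`. -/
def addMul (h : ℤ) : List ℤ → List ℤ → List ℤ
  | [], [] => []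
  | [], b :: q => h * b :: addMul h [] q
  | a :: p, [] => a :: p
  | a :: p, b :: q => (a + h * b) :: addMul h p q

/-- The polynomial `p (h + y)`. -/
def shift (h : ℤ) : List ℤ → List ℤ
  | [] => []
  | a :: p => addMul h (a :: shift h p) (shift h p)

def derivAux : ℤ → List ℤ → List ℤ
  | _, [] => []
  | k, a :: p => k * a :: derivAux (k + 1) p

def deriv (p : List ℤ) : List ℤ := derivAux 1 p.tail

/-- A bound for `|p y|` on `|y| ≤ s`. -/
def bound (s : ℕ) : List ℤ → ℕ
  | [] => 0
  | a :: p => a.natAbs + s * bound s p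

end UniPoly

namespace BiPoly

/-- `P + h * Q`. -/
def addMul (h : ℤ) : BiPoly → BiPoly → BiPoly
  | [], [] => []
  | [], b :: q => UniPoly.addMul h [] b :: addMul h [] q
  | a :: p, [] => a :: p
  | a :: p, b :: q => UniPoly.addMul h a b :: addMul h p q

def shiftX (h : ℤ) : BiPoly → BiPoly
  | [] => []
  | a :: p => addMul h (a :: shiftX h p) (shiftX h p)

def shiftY (h : ℤ) (P : BiPoly) : BiPoly := P.map (UniPoly.shift h)

def derivXAux : ℤ → BiPoly → BiPoly
  | _, [] => []
  | k, a :: p => a.map (k * ·) :: derivXAux (k + 1) p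

def derivX (P : BiPoly) : BiPoly := derivXAux 1 P.tail

def derivY (P : BiPoly) : BiPoly := P.map UniPoly.deriv

/-- A bound for `|P x y|` on `|x| ≤ r`, `|y| ≤ s`. -/
def bound (r s : ℕ) : BiPoly → ℕ
  | [] => 0
  | a :: p => UniPoly.bound s a + r * bound r s p

/-- The constant term is positive and dominates the others on `|x| ≤ r`, `|y| ≤ s`. -/
def isPos (r s : ℕ) : BiPoly → Bool
  | (Int.ofNat c :: a) :: p => Nat.blt (s * UniPoly.bound s a + r * bound r s p) c
  | _ => false

/-- The constant term is negative and dominates the others on `|x| ≤ r`, `|y| ≤ s`. -/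
def isNeg (r s : ℕ) : BiPoly → Bool
  | (Int.negSucc c :: a) :: p => Nat.ble (s * UniPoly.bound s a + r * bound r s p) c
  | _ => false

end BiPoly

open BiPoly

/-- Whether the box `b`, where `P` is expanded at its centre, can be covered by at most `2 ^ n` boxes
satisfying `test`. -/
def subdivide (test : BiPoly → Box → Bool) : ℕ → BiPoly → Box → Bool
  | 0, P, b => test P b
  | n + 1, P, b => test P b ||
      bif Nat.ble b.s b.r then
        subdivide test n (shiftX ((b.r + 1) / 2 : ℕ) P) ⟨b.x + ((b.r + 1) / 2 : ℕ), b.y, (b.r + 1) / 2, b.s⟩ &&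
        subdivide test n (shiftX (-((b.r + 1) / 2 : ℕ)) P) ⟨b.x - ((b.r + 1) / 2 : ℕ), b.y, (b.r + 1) / 2, b.s⟩
      else
        subdivide test n (shiftY ((b.s + 1) / 2 : ℕ) P) ⟨b.x, b.y + ((b.s + 1) / 2 : ℕ), b.r, (b.s + 1) / 2⟩ &&
        subdivide test n (shiftY (-((b.s + 1) / 2 : ℕ)) P) ⟨b.x, b.y - ((b.s + 1) / 2 : ℕ), b.r, (b.s + 1) / 2⟩

/-- Whether `b` can be covered by boxes on which the expansion of `P` satisfies `test`. -/
def holdsOn (test : BiPoly → Box → Bool) (P : BiPoly) (b : Box) : Bool :=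
  subdivide test 24 (shiftX b.x (shiftY b.y P)) b

def posTest (P : BiPoly) (b : Box) : Bool := isPos b.r b.s P
def negTest (P : BiPoly) (b : Box) : Bool := isNeg b.r b.s P

def Box.left (b : Box) : Box := ⟨b.x - b.r, b.y, 0, b.s⟩
def Box.right (b : Box) : Box := ⟨b.x + b.r, b.y, 0, b.s⟩
def Box.bottom (b : Box) : Box := ⟨b.x, b.y - b.s, b.r, 0⟩
def Box.top (b : Box) : Box := ⟨b.x, b.y + b.s, b.r, 0⟩

def Box.le (b c : Box) : Bool :=
  Nat.ble ((b.x - c.x).natAbs + b.r) c.r && Nat.ble ((b.y - c.y).natAbs + b.s) c.s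

/-- Certifies that `P` vanishes exactly once on each horizontal segment of `b`. -/
def peakTest (P : BiPoly) (b : Box) : Bool :=
  holdsOn posTest P b.left && holdsOn negTest P b.right && holdsOn negTest (derivX P) b

/-- Certifies that `P` is negative on the boundary of `b`. -/
def fenceTest (P : BiPoly) (b : Box) : Bool :=
  holdsOn negTest P b.left && holdsOn negTest P b.right && holdsOn negTest P b.bottom &&
    holdsOn negTest P b.top

/-- Certifies that, outside the boxes of `l`, the first coordinate has no local maximum on the zero
set of `P` in `b`. -/
def noPeakTest (l : List Box) (P : BiPoly) (b : Box) : Bool :=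
  isPos b.r b.s P || isNeg b.r b.s P || isPos b.r b.s (derivY P) || isNeg b.r b.s (derivY P) ||
    isPos b.r b.s (derivX P) && isNeg b.r b.s (derivY (derivY P)) || l.any b.le

/-- `8 * N ^ 6 * Hess f` in the coordinates `u = N * (y - x)`, `v = N * (x + y)`. -/
def affineChart (N : ℤ) : BiPoly :=
  [[-776 * N ^ 6, -1104 * N ^ 5, 15216 * N ^ 4, 33556 * N ^ 3, -12204 * N ^ 2, -44160 * N, -18623],
   [16656 * N ^ 5, 25824 * N ^ 4, -37476 * N ^ 3, -56124 * N ^ 2, -140532 * N, -43380],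
   [-94560 * N ^ 4, -126180 * N ^ 3, 130140 * N ^ 2, 164544 * N, -404631],
   [37716 * N ^ 3, 26028 * N ^ 2, 149112 * N, 141504],
   [134136 * N ^ 2, 57888 * N, 170307],
   [-34020 * N, -27756],
   [-60813]]

/-- Homogenised in a third variable `w`, then restricted to `u = N`, in the coordinates `w`, `v`. -/
def firstChartAtInfinity (N : ℤ) : BiPoly :=
  [[-60813 * N ^ 6, -27756 * N ^ 5, 170307 * N ^ 4, 141504 * N ^ 3, -404631 * N ^ 2, -43380 * N, -18623],
   [-34020 * N ^ 5, 57888 * N ^ 4, 149112 * N ^ 3, 164544 * N ^ 2, -140532 * N, -44160],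
   [134136 * N ^ 4, 26028 * N ^ 3, 130140 * N ^ 2, -56124 * N, -12204],
   [37716 * N ^ 3, -126180 * N ^ 2, -37476 * N, 33556],
   [-94560 * N ^ 2, 25824 * N, 15216],
   [16656 * N, -1104],
   [-776]]

/-- Homogenised in a third variable `w`, then restricted to `v = N`, in the coordinates `w`, `u`. -/
def secondChartAtInfinity (N : ℤ) : BiPoly :=
  [[-18623 * N ^ 6, -43380 * N ^ 5, -404631 * N ^ 4, 141504 * N ^ 3, 170307 * N ^ 2, -27756 * N, -60813],
   [-44160 * N ^ 5, -140532 * N ^ 4, 164544 * N ^ 3, 149112 * N ^ 2, 57888 * N, -34020],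
   [-12204 * N ^ 4, -56124 * N ^ 3, 130140 * N ^ 2, 26028 * N, 134136],
   [33556 * N ^ 3, -37476 * N ^ 2, -126180 * N, 37716],
   [15216 * N ^ 2, 25824 * N, -94560],
   [-1104 * N, 16656],
   [-776]]

/-- For each oval of the hessian curve, a box around its point with maximal `u` and a box around the
whole oval. -/
def ovals : List (Box × Box) :=
  [(⟨1473, -648, 148, 138⟩, ⟨1028, -390, 595, 425⟩),
   (⟨-73, -1213, 11, 92⟩, ⟨-97, -1136, 37, 189⟩),
   (⟨2991, 1874, 81, 117⟩, ⟨1820, 1054, 1254, 967⟩),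
   (⟨-110, -694, 9, 72⟩, ⟨-140, -764, 45, 160⟩),
   (⟨157, -233, 58, 123⟩, ⟨94, -226, 123, 207⟩),
   (⟨-861, -575, 181, 153⟩, ⟨-1105, -556, 427, 290⟩),
   (⟨229, 411, 85, 153⟩, ⟨-61, 552, 377, 554⟩),
   (⟨-1229, 677, 82, 153⟩, ⟨-1681, 749, 536, 391⟩)]

theorem holdsOn_firstChartAtInfinity :
    holdsOn negTest (firstChartAtInfinity 16) ⟨0, 0, 4, 16⟩ = true := by decide +kernel

theorem holdsOn_secondChartAtInfinity :
    holdsOn negTest (secondChartAtInfinity 16) ⟨0, 0, 4, 16⟩ = true := by decide +kernel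

theorem peakTest_ovals : ∀ o ∈ ovals, peakTest (affineChart 1024) o.1 = true :=
  List.all_eq_true.1 (by decide +kernel)

theorem fenceTest_ovals : ∀ o ∈ ovals, fenceTest (affineChart 1024) o.2 = true :=
  List.all_eq_true.1 (by decide +kernel)

theorem noPeakTest_ovals :
    holdsOn (noPeakTest (ovals.map Prod.fst)) (affineChart 1024) ⟨0, 0, 4096, 4096⟩ = true := by
  decide +kernel

theorem le_ovals : ∀ o ∈ ovals, o.1.le o.2 = true := by decide

theorem pairwise_ovals : ovals.Pairwise fun o o' ↦
    o.2.r + o'.2.r < (o.2.x - o'.2.x).natAbs ∨ o.2.s + o'.2.s < (o.2.y - o'.2.y).natAbs := by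
  decide

noncomputable section

namespace UniPoly

def eval (y : ℝ) : List ℤ → ℝ
  | [] => 0
  | a :: p => a + y * eval y p

theorem eval_addMul (y : ℝ) (h : ℤ) (p q : List ℤ) :
    eval y (addMul h p q) = eval y p + h * eval y q := by
  fun_induction addMul h p q <;> simp_all [eval] <;> ring_nf

theorem eval_shift (y : ℝ) (h : ℤ) (p : List ℤ) : eval y (shift h p) = eval (h + y) p := by
  induction p with
  | nil => rfl
  | cons a p ih => simp only [shift, eval_addMul, eval, ih]; ring

theorem eval_derivAux_add_one (y : ℝ) (k : ℤ) (p : List ℤ) :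
    eval y (derivAux (k + 1) p) = eval y (derivAux k p) + eval y p := by
  induction p generalizing k with
  | nil => simp [derivAux, eval]
  | cons a p ih => simp only [derivAux, eval, ih (k + 1)]; push_cast; ring

theorem eval_deriv_cons (y : ℝ) (a : ℤ) (p : List ℤ) :
    eval y (deriv (a :: p)) = eval y p + y * eval y (deriv p) := by
  cases p with
  | nil => simp [deriv, derivAux, eval]
  | cons a p =>
    simp only [deriv, derivAux, eval, eval_derivAux_add_one, List.tail_cons]
    push_cast; ring

theorem hasDerivAt_eval (p : List ℤ) (y : ℝ) :
    HasDerivAt (fun t ↦ eval t p) (eval y (deriv p)) y := by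
  induction p with
  | nil => simpa [eval, deriv, derivAux] using hasDerivAt_const y (0 : ℝ)
  | cons a p ih =>
    refine (((hasDerivAt_id y).mul ih).const_add (a : ℝ)).congr_deriv ?_
    simp [eval_deriv_cons]

theorem abs_eval_le {y : ℝ} {s : ℕ} (hy : |y| ≤ s) (p : List ℤ) : |eval y p| ≤ bound s p := by
  induction p with
  | nil => simp [eval, bound]
  | cons a p ih =>
    calc |eval y (a :: p)| ≤ |(a : ℝ)| + |y| * |eval y p| := by
          rw [eval, ← abs_mul]; exact abs_add_le _ _
      _ ≤ |(a : ℝ)| + s * bound s p := by gcongr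
      _ = bound s (a :: p) := by simp [bound, Nat.cast_natAbs]

end UniPoly

namespace BiPoly

def eval (x y : ℝ) : BiPoly → ℝ
  | [] => 0
  | a :: P => UniPoly.eval y a + x * eval x y P

theorem eval_addMul (x y : ℝ) (h : ℤ) (P Q : BiPoly) :
    eval x y (addMul h P Q) = eval x y P + h * eval x y Q := by
  fun_induction addMul h P Q <;> simp_all [eval, UniPoly.eval, UniPoly.eval_addMul] <;> ring_nf

theorem eval_shiftX (x y : ℝ) (h : ℤ) (P : BiPoly) :
    eval x y (shiftX h P) = eval (h + x) y P := by
  induction P with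
  | nil => rfl
  | cons a P ih => simp only [shiftX, eval_addMul, eval, ih]; ring

theorem eval_shiftY (x y : ℝ) (h : ℤ) (P : BiPoly) :
    eval x y (shiftY h P) = eval x (h + y) P := by
  induction P with
  | nil => rfl
  | cons a P ih => simp_all [shiftY, eval, UniPoly.eval_shift]

theorem eval_map_mul (y : ℝ) (k : ℤ) (p : List ℤ) :
    UniPoly.eval y (p.map (k * ·)) = k * UniPoly.eval y p := by
  induction p with
  | nil => simp [UniPoly.eval]
  | cons a p ih => simp only [List.map_cons, UniPoly.eval, ih]; push_cast; ring

theorem eval_derivXAux_add_one (x y : ℝ) (k : ℤ) (P : BiPoly) :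
    eval x y (derivXAux (k + 1) P) = eval x y (derivXAux k P) + eval x y P := by
  induction P generalizing k with
  | nil => simp [derivXAux, eval]
  | cons a P ih => simp only [derivXAux, eval, ih (k + 1), eval_map_mul]; push_cast; ring

theorem eval_derivX_cons (x y : ℝ) (a : List ℤ) (P : BiPoly) :
    eval x y (derivX (a :: P)) = eval x y P + x * eval x y (derivX P) := by
  cases P with
  | nil => simp [derivX, derivXAux, eval]
  | cons a P =>
    simp only [derivX, derivXAux, eval, eval_derivXAux_add_one, List.tail_cons, eval_map_mul]
    push_cast; ring

theorem hasDerivAt_eval_fst (P : BiPoly) (x y : ℝ) :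
    HasDerivAt (fun t ↦ eval t y P) (eval x y (derivX P)) x := by
  induction P with
  | nil => simpa [eval, derivX, derivXAux] using hasDerivAt_const x (0 : ℝ)
  | cons a P ih =>
    refine (((hasDerivAt_id x).mul ih).const_add (UniPoly.eval y a)).congr_deriv ?_
    simp [eval_derivX_cons]

theorem hasDerivAt_eval_snd (P : BiPoly) (x y : ℝ) :
    HasDerivAt (fun t ↦ eval x t P) (eval x y (derivY P)) y := by
  induction P with
  | nil => simpa [eval, derivY] using hasDerivAt_const y (0 : ℝ)
  | cons a P ih => exact (UniPoly.hasDerivAt_eval a y).add (ih.const_mul x)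

theorem continuous_eval (P : BiPoly) : Continuous fun p : ℝ × ℝ ↦ eval p.1 p.2 P := by
  induction P with
  | nil => exact continuous_const
  | cons a P ih =>
    have ha : Continuous fun y ↦ UniPoly.eval y a :=
      continuous_iff_continuousAt.2 fun y ↦ (UniPoly.hasDerivAt_eval a y).continuousAt
    exact (ha.comp continuous_snd).add (continuous_fst.mul ih)

theorem abs_eval_le {x y : ℝ} {r s : ℕ} (hx : |x| ≤ r) (hy : |y| ≤ s) (P : BiPoly) :
    |eval x y P| ≤ bound r s P := by
  induction P with
  | nil => simp [eval, bound]
  | cons a P ih =>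
    calc |eval x y (a :: P)| ≤ |UniPoly.eval y a| + |x| * |eval x y P| := by
          rw [eval, ← abs_mul]; exact abs_add_le _ _
      _ ≤ UniPoly.bound s a + r * bound r s P := by
          gcongr; exact UniPoly.abs_eval_le hy a
      _ = bound r s (a :: P) := by simp [bound]

theorem abs_eval_sub_le {x y : ℝ} {r s : ℕ} (hx : |x| ≤ r) (hy : |y| ≤ s) (c : ℤ) (a : List ℤ)
    (P : BiPoly) :
    |eval x y ((c :: a) :: P) - c| ≤ (s * UniPoly.bound s a + r * bound r s P : ℕ) := by
  have h := abs_eval_le hx hy ((0 :: a) :: P)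
  simp only [eval, UniPoly.eval, bound, UniPoly.bound] at h ⊢
  convert h using 2
  · push_cast; ring
  · simp

theorem eval_pos_of_isPos {x y : ℝ} {r s : ℕ} (hx : |x| ≤ r) (hy : |y| ≤ s) {P : BiPoly}
    (h : isPos r s P = true) : 0 < eval x y P := by
  unfold isPos at h
  split at h
  · rename_i c a P
    have h₁ := (abs_le.1 (abs_eval_sub_le hx hy (Int.ofNat c) a P)).1
    have h₂ : ((s * UniPoly.bound s a + r * bound r s P : ℕ) : ℝ) < c := by
      exact_mod_cast (Nat.blt_eq ▸ h :)
    simp only [Int.ofNat_eq_natCast, Int.cast_natCast] at h₁ ⊢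
    linarith
  · simp at h

theorem eval_neg_of_isNeg {x y : ℝ} {r s : ℕ} (hx : |x| ≤ r) (hy : |y| ≤ s) {P : BiPoly}
    (h : isNeg r s P = true) : eval x y P < 0 := by
  unfold isNeg at h
  split at h
  · rename_i c a P
    have h₁ := (abs_le.1 (abs_eval_sub_le hx hy (Int.negSucc c) a P)).2
    have h₂ : ((s * UniPoly.bound s a + r * bound r s P : ℕ) : ℝ) ≤ c := by
      exact_mod_cast Nat.le_of_ble_eq_true h
    rw [Int.cast_negSucc] at h₁
    push_cast at h₁ h₂
    linarith
  · simp at h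

/-- `P'` is the Taylor expansion of `P` at the centre of `b`. -/
def IsExpansion (P : BiPoly) (b : Box) (P' : BiPoly) : Prop :=
  ∀ x y, eval x y P' = eval (b.x + x) (b.y + y) P

theorem IsExpansion.derivX {P P' : BiPoly} {b : Box} (h : IsExpansion P b P') :
    IsExpansion (derivX P) b (BiPoly.derivX P') := fun x y ↦ by
  refine (hasDerivAt_eval_fst P' x y).unique ?_
  simp only [h _ _]
  exact (hasDerivAt_eval_fst P _ _).comp_const_add _ _

theorem IsExpansion.derivY {P P' : BiPoly} {b : Box} (h : IsExpansion P b P') :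
    IsExpansion (derivY P) b (BiPoly.derivY P') := fun x y ↦ by
  refine (hasDerivAt_eval_snd P' x y).unique ?_
  simp only [h _ _]
  exact (hasDerivAt_eval_snd P _ _).comp_const_add _ _

end BiPoly

def Box.toSet (b : Box) : Set (ℝ × ℝ) := {p | |p.1 - b.x| ≤ b.r ∧ |p.2 - b.y| ≤ b.s}

theorem BiPoly.IsExpansion.pos {P P' : BiPoly} {b : Box} (h : IsExpansion P b P')
    (h' : isPos b.r b.s P' = true) {p : ℝ × ℝ} (hp : p ∈ b.toSet) : 0 < eval p.1 p.2 P := by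
  simpa [h _ _] using eval_pos_of_isPos hp.1 hp.2 h'

theorem BiPoly.IsExpansion.neg {P P' : BiPoly} {b : Box} (h : IsExpansion P b P')
    (h' : isNeg b.r b.s P' = true) {p : ℝ × ℝ} (hp : p ∈ b.toSet) : eval p.1 p.2 P < 0 := by
  simpa [h _ _] using eval_neg_of_isNeg hp.1 hp.2 h'

theorem abs_sub_half_le {t : ℝ} {r : ℕ} (h : |t| ≤ r) :
    |t - ((r + 1) / 2 : ℕ)| ≤ ((r + 1) / 2 : ℕ) ∨ |t + ((r + 1) / 2 : ℕ)| ≤ ((r + 1) / 2 : ℕ) := by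
  have h₁ : (r : ℝ) ≤ 2 * ((r + 1) / 2 : ℕ) := by exact_mod_cast (by omega : r ≤ 2 * ((r + 1) / 2))
  have h₂ := abs_le.1 h
  rcases le_total 0 t with ht | ht
  · exact .inl (abs_le.2 ⟨by linarith, by linarith⟩)
  · exact .inr (abs_le.2 ⟨by linarith, by linarith⟩)

theorem of_subdivide {test : BiPoly → Box → Bool} {P : BiPoly} {Q : ℝ × ℝ → Prop}
    (hQ : ∀ P' b, IsExpansion P b P' → test P' b = true → ∀ p ∈ b.toSet, Q p) (n : ℕ)
    {P' : BiPoly} {b : Box} (hP : IsExpansion P b P') (h : subdivide test n P' b = true)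
    {p : ℝ × ℝ} (hp : p ∈ b.toSet) : Q p := by
  induction n generalizing P' b with
  | zero => exact hQ P' b hP h p hp
  | succ n ih =>
    simp only [subdivide, Bool.or_eq_true] at h
    obtain h | h := h
    · exact hQ P' b hP h p hp
    cases hb : Nat.ble b.s b.r <;> simp only [hb, cond_true, cond_false, Bool.and_eq_true] at h
    · rcases abs_sub_half_le hp.2 with hy | hy
      · refine ih (fun x y ↦ ?_) h.1 ⟨hp.1, ?_⟩
        · rw [eval_shiftY, hP]; push_cast; ring_nf
        · push_cast at hy ⊢; rwa [← sub_sub]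
      · refine ih (fun x y ↦ ?_) h.2 ⟨hp.1, ?_⟩
        · rw [eval_shiftY, hP]; push_cast; ring_nf
        · push_cast at hy ⊢; rwa [sub_sub_eq_add_sub, add_sub_right_comm]
    · rcases abs_sub_half_le hp.1 with hx | hx
      · refine ih (fun x y ↦ ?_) h.1 ⟨?_, hp.2⟩
        · rw [eval_shiftX, hP]; push_cast; ring_nf
        · push_cast at hx ⊢; rwa [← sub_sub]
      · refine ih (fun x y ↦ ?_) h.2 ⟨?_, hp.2⟩
        · rw [eval_shiftX, hP]; push_cast; ring_nf
        · push_cast at hx ⊢; rwa [sub_sub_eq_add_sub, add_sub_right_comm]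

theorem of_holdsOn {test : BiPoly → Box → Bool} {P : BiPoly} {Q : ℝ × ℝ → Prop}
    (hQ : ∀ P' b, IsExpansion P b P' → test P' b = true → ∀ p ∈ b.toSet, Q p)
    {b : Box} (h : holdsOn test P b = true) {p : ℝ × ℝ} (hp : p ∈ b.toSet) : Q p :=
  of_subdivide hQ 24 (fun x y ↦ by rw [eval_shiftX, eval_shiftY]) h hp

theorem eval_pos_of_holdsOn {P : BiPoly} {b : Box} (h : holdsOn posTest P b = true) {p : ℝ × ℝ}
    (hp : p ∈ b.toSet) : 0 < eval p.1 p.2 P :=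
  of_holdsOn (Q := fun p ↦ 0 < eval p.1 p.2 P) (fun _ _ hP h _ hp ↦ hP.pos h hp) h hp

theorem eval_neg_of_holdsOn {P : BiPoly} {b : Box} (h : holdsOn negTest P b = true) {p : ℝ × ℝ}
    (hp : p ∈ b.toSet) : eval p.1 p.2 P < 0 :=
  of_holdsOn (Q := fun p ↦ eval p.1 p.2 P < 0) (fun _ _ hP h _ hp ↦ hP.neg h hp) h hp

theorem Box.toSet_subset_of_le {b c : Box} (h : b.le c = true) : b.toSet ⊆ c.toSet := by
  simp only [Box.le, Bool.and_eq_true, Nat.ble_eq] at h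
  intro p hp
  have h₁ : |(b.x - c.x : ℝ)| + b.r ≤ c.r := by
    have := h.1; rw [← @Nat.cast_le ℝ] at this; simpa [Nat.cast_natAbs] using this
  have h₂ : |(b.y - c.y : ℝ)| + b.s ≤ c.s := by
    have := h.2; rw [← @Nat.cast_le ℝ] at this; simpa [Nat.cast_natAbs] using this
  exact ⟨(abs_sub_le _ _ _).trans (by linarith [hp.1]), (abs_sub_le _ _ _).trans (by linarith [hp.2])⟩

theorem of_noPeakTest {l : List Box} {P : BiPoly} {b : Box}
    (h : holdsOn (noPeakTest l) P b = true) {p : ℝ × ℝ} (hp : p ∈ b.toSet)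
    (h₀ : eval p.1 p.2 P = 0) (hY : eval p.1 p.2 (derivY P) = 0)
    (hX : ¬ (0 < eval p.1 p.2 (derivX P) ∧ eval p.1 p.2 (derivY (derivY P)) < 0)) :
    ∃ c ∈ l, p ∈ c.toSet := by
  refine of_holdsOn (Q := fun p ↦ eval p.1 p.2 P = 0 → eval p.1 p.2 (derivY P) = 0 →
    ¬ (0 < eval p.1 p.2 (derivX P) ∧ eval p.1 p.2 (derivY (derivY P)) < 0) →
    ∃ c ∈ l, p ∈ c.toSet) (fun P' b hP h p hp h₀ hY hX ↦ ?_) h hp h₀ hY hX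
  simp only [noPeakTest, Bool.or_eq_true, Bool.and_eq_true, List.any_eq_true] at h
  obtain ((((h | h) | h) | h) | h) | ⟨c, hc, h⟩ := h
  · exact absurd h₀ (hP.pos h hp).ne'
  · exact absurd h₀ (hP.neg h hp).ne
  · exact absurd hY (hP.derivY.pos h hp).ne'
  · exact absurd hY (hP.derivY.neg h hp).ne
  · exact absurd ⟨hP.derivX.pos h.1 hp, hP.derivY.derivY.neg h.2 hp⟩ hX
  · exact ⟨c, hc, Box.toSet_subset_of_le h hp⟩


section Topology

open Set Topology Filter

theorem isPreconnected_of_injOn {X Y : Type*} [TopologicalSpace X] [TopologicalSpace Y] [T2Space Y]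
    {S : Set X} {φ : X → Y} (hS : IsCompact S) (hφ : Continuous φ) (hinj : InjOn φ S)
    (h : IsPreconnected (φ '' S)) : IsPreconnected S := by
  rw [isPreconnected_closed_iff] at h ⊢
  rintro s t hs ht hst ⟨a, haS, has⟩ ⟨b, hbS, hbt⟩
  obtain ⟨_, -, ⟨c, ⟨hcS, hcs⟩, rfl⟩, ⟨d, ⟨hdS, hdt⟩, hdc⟩⟩ :=
    h (φ '' (S ∩ s)) (φ '' (S ∩ t)) ((hS.inter_right hs).image hφ).isClosed
      ((hS.inter_right ht).image hφ).isClosed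
      (by
        rw [← image_union, ← inter_union_distrib_left]
        exact image_mono (subset_inter subset_rfl hst))
      ⟨φ a, ⟨a, haS, rfl⟩, a, ⟨haS, has⟩, rfl⟩ ⟨φ b, ⟨b, hbS, rfl⟩, b, ⟨hbS, hbt⟩, rfl⟩
  obtain rfl := hinj hdS hcS hdc
  exact ⟨d, hdS, hcs, hdt⟩

theorem existsUnique_zero_of_deriv_pos {φ φ' : ℝ → ℝ} {a b : ℝ} (hab : a ≤ b)
    (hφ : ∀ t ∈ Icc a b, HasDerivAt φ (φ' t) t) (hφ' : ∀ t ∈ Icc a b, 0 < φ' t)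
    (ha : φ a ≤ 0) (hb : 0 ≤ φ b) : ∃! t, t ∈ Icc a b ∧ φ t = 0 := by
  have hc : ContinuousOn φ (Icc a b) := fun t ht ↦ (hφ t ht).continuousAt.continuousWithinAt
  have hm : StrictMonoOn φ (Icc a b) := strictMonoOn_of_deriv_pos (convex_Icc a b) hc fun t ht ↦ by
    have ht := interior_subset ht
    rw [(hφ t ht).deriv]
    exact hφ' t ht
  obtain ⟨t, ht, ht₀⟩ := intermediate_value_Icc hab hc ⟨ha, hb⟩
  exact ⟨t, ⟨ht, ht₀⟩, fun t' ht' ↦ hm.injOn ht'.1 ht (ht'.2.trans ht₀.symm)⟩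

theorem existsUnique_zero_of_deriv_neg {φ φ' : ℝ → ℝ} {a b : ℝ} (hab : a ≤ b)
    (hφ : ∀ t ∈ Icc a b, HasDerivAt φ (φ' t) t) (hφ' : ∀ t ∈ Icc a b, φ' t < 0)
    (ha : 0 ≤ φ a) (hb : φ b ≤ 0) : ∃! t, t ∈ Icc a b ∧ φ t = 0 := by
  simpa using existsUnique_zero_of_deriv_pos (φ := -φ) (φ' := -φ') hab (fun t ht ↦ (hφ t ht).neg)
    (by simpa using hφ') (by simpa using ha) (by simpa using hb)

theorem isPreconnected_zeros_of_existsUnique_fst {g : ℝ × ℝ → ℝ} (hg : Continuous g)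
    {a b c d : ℝ} (h : ∀ y ∈ Icc c d, ∃! x, x ∈ Icc a b ∧ g (x, y) = 0) :
    IsPreconnected ({p | g p = 0} ∩ Icc a b ×ˢ Icc c d) := by
  refine isPreconnected_of_injOn (φ := Prod.snd)
    ((isCompact_Icc.prod isCompact_Icc).inter_left (isClosed_eq hg continuous_const))
    continuous_snd ?_ ?_
  · rintro ⟨x, y⟩ ⟨h₀, hx, hy⟩ ⟨x', y'⟩ ⟨h₀', hx', -⟩ (rfl : y = y')
    exact Prod.ext ((h y hy).unique ⟨hx, h₀⟩ ⟨hx', h₀'⟩) rfl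
  · convert isPreconnected_Icc (a := c) (b := d)
    ext y
    constructor
    · rintro ⟨p, hp, rfl⟩
      exact hp.2.2
    · intro hy
      obtain ⟨x, hx, h₀⟩ := (h y hy).exists
      exact ⟨(x, y), ⟨h₀, hx, hy⟩, rfl⟩

theorem isPreconnected_zeros_of_existsUnique_snd {g : ℝ × ℝ → ℝ} (hg : Continuous g)
    {a b c d : ℝ} (h : ∀ x ∈ Icc a b, ∃! y, y ∈ Icc c d ∧ g (x, y) = 0) :
    IsPreconnected ({p | g p = 0} ∩ Icc a b ×ˢ Icc c d) := by
  convert (isPreconnected_zeros_of_existsUnique_fst (hg.comp continuous_swap) h).image Prod.swap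
    continuous_swap.continuousOn
  ext ⟨x, y⟩
  simp [and_comm]

/-- The point `p` can be joined inside `s` to a point with larger first coordinate. -/
def CanMoveRight (s : Set (ℝ × ℝ)) (p : ℝ × ℝ) : Prop :=
  ∃ t ⊆ s, IsPreconnected t ∧ p ∈ t ∧ ∃ q ∈ t, p.1 < q.1

theorem exists_mem_connectedComponentIn_not_canMoveRight {s : Set (ℝ × ℝ)} (hs : IsCompact s)
    {p : ℝ × ℝ} (hp : p ∈ s) : ∃ q ∈ connectedComponentIn s p, ¬ CanMoveRight s q := by
  have hc : IsCompact (connectedComponentIn s p) := by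
    rw [connectedComponentIn_eq_image hp]
    have := isCompact_iff_compactSpace.1 hs
    exact isClosed_connectedComponent.isCompact.image continuous_subtype_val
  obtain ⟨q, hq, hmax⟩ :=
    hc.exists_isMaxOn ⟨p, mem_connectedComponentIn hp⟩ continuous_fst.continuousOn
  refine ⟨q, hq, fun ⟨t, hts, ht, hqt, q', hq't, hlt⟩ ↦ hlt.not_ge (hmax ?_)⟩
  rw [connectedComponentIn_eq hq]
  exact ht.subset_connectedComponentIn hqt hts hq't

theorem exists_rectangle_of_eventually {x y : ℝ} {P : ℝ × ℝ → Prop} (h : ∀ᶠ p in 𝓝 (x, y), P p) :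
    ∃ ε > 0, ∀ p ∈ Icc (x - ε) (x + ε) ×ˢ Icc (y - ε) (y + ε), P p := by
  obtain ⟨ε, hε, h⟩ := Metric.nhds_basis_closedBall.eventually_iff.1 h
  refine ⟨ε, hε, fun p hp ↦ h ?_⟩
  rwa [← closedBall_prod_same, Real.closedBall_eq_Icc, Real.closedBall_eq_Icc]

theorem exists_Icc_of_eventually {x r : ℝ} (hr : 0 < r) {P : ℝ → Prop} (h : ∀ᶠ t in 𝓝 x, P t) :
    ∃ δ > 0, δ ≤ r ∧ ∀ t ∈ Icc x (x + δ), P t := by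
  obtain ⟨δ, hδ, h⟩ := Metric.nhds_basis_closedBall.eventually_iff.1 h
  refine ⟨min δ r, lt_min hδ hr, min_le_right _ _, fun t ht ↦ h ?_⟩
  rw [Real.closedBall_eq_Icc]
  exact ⟨by linarith [ht.1], by linarith [ht.2, min_le_left δ r]⟩

theorem canMoveRight_of_deriv_snd_pos {g gy : ℝ × ℝ → ℝ} (hg : Continuous g) (hgy : Continuous gy)
    (h : ∀ x y, HasDerivAt (fun t ↦ g (x, t)) (gy (x, y)) y) {p : ℝ × ℝ} (hp : g p = 0)
    (hpos : 0 < gy p) : CanMoveRight {p | g p = 0} p := by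
  obtain ⟨x, y⟩ := p
  obtain ⟨ε, hε, hε'⟩ := exists_rectangle_of_eventually
    (hgy.continuousAt.eventually (lt_mem_nhds hpos))
  have hmono : StrictMonoOn (fun t ↦ g (x, t)) (Icc (y - ε) (y + ε)) :=
    strictMonoOn_of_deriv_pos (convex_Icc _ _) (by fun_prop) fun t ht ↦ by
      rw [(h x t).deriv]
      exact hε' (x, t) ⟨⟨by linarith, by linarith⟩, interior_subset ht⟩
  have hlow : g (x, y - ε) < 0 := hp ▸ hmono ⟨by linarith, by linarith⟩ ⟨by linarith, by linarith⟩
    (by linarith)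
  have hhigh : 0 < g (x, y + ε) := hp ▸ hmono ⟨by linarith, by linarith⟩
    ⟨by linarith, by linarith⟩ (by linarith)
  obtain ⟨δ, hδ, hδε, hδ'⟩ := exists_Icc_of_eventually hε
    (((show Continuous fun t ↦ g (t, y - ε) by fun_prop).continuousAt.eventually
      (gt_mem_nhds hlow)).and
    ((show Continuous fun t ↦ g (t, y + ε) by fun_prop).continuousAt.eventually
      (lt_mem_nhds hhigh)))
  have huniq : ∀ t ∈ Icc x (x + δ), ∃! u, u ∈ Icc (y - ε) (y + ε) ∧ g (t, u) = 0 := fun t ht ↦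
    existsUnique_zero_of_deriv_pos (by linarith) (fun u _ ↦ h t u)
      (fun u hu ↦ hε' (t, u) ⟨⟨by linarith [ht.1], by linarith [ht.2]⟩, hu⟩)
      (hδ' t ht).1.le (hδ' t ht).2.le
  have hx : x + δ ∈ Icc x (x + δ) := ⟨by linarith, le_rfl⟩
  obtain ⟨u, hu, hu₀⟩ := (huniq _ hx).exists
  exact ⟨_, inter_subset_left, isPreconnected_zeros_of_existsUnique_snd hg huniq,
    ⟨hp, ⟨le_rfl, by linarith⟩, by linarith, by linarith⟩, (x + δ, u), ⟨hu₀, hx, hu⟩,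
    show x < x + δ by linarith⟩

theorem canMoveRight_of_deriv_snd_ne_zero {g gy : ℝ × ℝ → ℝ} (hg : Continuous g)
    (hgy : Continuous gy) (h : ∀ x y, HasDerivAt (fun t ↦ g (x, t)) (gy (x, y)) y) {p : ℝ × ℝ}
    (hp : g p = 0) (hne : gy p ≠ 0) : CanMoveRight {p | g p = 0} p := by
  rcases hne.lt_or_gt with hneg | hpos
  · simpa using canMoveRight_of_deriv_snd_pos hg.neg hgy.neg (fun x y ↦ (h x y).neg)
      (by simpa using hp) (by simpa using hneg)
  · exact canMoveRight_of_deriv_snd_pos hg hgy h hp hpos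

theorem canMoveRight_of_deriv_fst_pos {g gx gy gyy : ℝ × ℝ → ℝ} (hg : Continuous g)
    (hgx : Continuous gx) (hgyy : Continuous gyy)
    (hx : ∀ x y, HasDerivAt (fun t ↦ g (t, y)) (gx (x, y)) x)
    (hy : ∀ x y, HasDerivAt (fun t ↦ g (x, t)) (gy (x, y)) y)
    (hyy : ∀ x y, HasDerivAt (fun t ↦ gy (x, t)) (gyy (x, y)) y) {p : ℝ × ℝ} (hp : g p = 0)
    (hpy : gy p = 0) (hpos : 0 < gx p) (hneg : gyy p < 0) : CanMoveRight {p | g p = 0} p := by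
  obtain ⟨x, y⟩ := p
  obtain ⟨ε, hε, hε'⟩ := exists_rectangle_of_eventually
    ((hgx.continuousAt.eventually (lt_mem_nhds hpos)).and
      (hgyy.continuousAt.eventually (gt_mem_nhds hneg)))
  have hy_neg : ∀ t ∈ Ioc y (y + ε), gy (x, t) < 0 := by
    have : StrictAntiOn (fun t ↦ gy (x, t)) (Icc y (y + ε)) :=
      strictAntiOn_of_deriv_neg (convex_Icc _ _)
        (fun t _ ↦ (hyy x t).continuousAt.continuousWithinAt) fun t ht ↦ by
        have ht := interior_subset ht
        rw [(hyy x t).deriv]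
        exact (hε' (x, t) ⟨⟨by linarith, by linarith⟩, by linarith [ht.1], ht.2⟩).2
    exact fun t ht ↦ hpy ▸ this ⟨le_rfl, by linarith⟩ ⟨ht.1.le, ht.2⟩ ht.1
  have h_neg : ∀ t ∈ Ioc y (y + ε), g (x, t) < 0 := by
    have : StrictAntiOn (fun t ↦ g (x, t)) (Icc y (y + ε)) :=
      strictAntiOn_of_deriv_neg (convex_Icc _ _) (by fun_prop) fun t ht ↦ by
        rw [interior_Icc] at ht
        rw [(hy x t).deriv]
        exact hy_neg t ⟨ht.1, ht.2.le⟩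
    exact fun t ht ↦ hp ▸ this ⟨le_rfl, by linarith⟩ ⟨ht.1.le, ht.2⟩ ht.1
  have hright : 0 < g (x + ε, y) := by
    have : StrictMonoOn (fun t ↦ g (t, y)) (Icc x (x + ε)) :=
      strictMonoOn_of_deriv_pos (convex_Icc _ _) (by fun_prop) fun t ht ↦ by
        have ht := interior_subset ht
        rw [(hx t y).deriv]
        exact (hε' (t, y) ⟨⟨by linarith [ht.1], ht.2⟩, by linarith, by linarith⟩).1
    exact hp ▸ this ⟨le_rfl, by linarith⟩ ⟨by linarith, le_rfl⟩ (by linarith)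
  obtain ⟨δ, hδ, hδε, hδ'⟩ := exists_Icc_of_eventually hε
    ((show Continuous fun t ↦ g (x + ε, t) by fun_prop).continuousAt.eventually
      (lt_mem_nhds hright))
  have huniq : ∀ t ∈ Icc y (y + δ), ∃! u, u ∈ Icc x (x + ε) ∧ g (u, t) = 0 := fun t ht ↦
    existsUnique_zero_of_deriv_pos (by linarith) (fun u _ ↦ hx u t)
      (fun u hu ↦ (hε' (u, t) ⟨⟨by linarith [hu.1], hu.2⟩, by linarith [ht.1],
        by linarith [ht.2]⟩).1)
      (ht.1.eq_or_lt.elim (fun h ↦ h ▸ hp.le) fun h ↦ (h_neg t ⟨h, by linarith [ht.2]⟩).le)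
      (hδ' t ht).le
  have hyδ : y + δ ∈ Icc y (y + δ) := ⟨by linarith, le_rfl⟩
  obtain ⟨u, hu, hu₀⟩ := (huniq _ hyδ).exists
  refine ⟨_, inter_subset_left, isPreconnected_zeros_of_existsUnique_fst hg huniq,
    ⟨hp, ⟨le_rfl, by linarith⟩, le_rfl, by linarith⟩, (u, y + δ), ⟨hu₀, hu, hyδ⟩,
    hu.1.lt_of_ne ?_⟩
  rintro (rfl : x = u)
  exact (h_neg (y + δ) ⟨by linarith, by linarith⟩).ne hu₀

theorem _root_.IsPreconnected.subset_of_disjoint_frontier {X : Type*} [TopologicalSpace X]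
    {C U : Set X} (hC : IsPreconnected C) (hU : Disjoint (frontier U) C) (h : (C ∩ U).Nonempty) :
    C ⊆ U := by
  have hcover : C ⊆ interior U ∪ (closure U)ᶜ := fun x hx ↦ by
    by_cases hx' : x ∈ closure U
    · by_contra hcon
      exact hU.notMem_of_mem_left ⟨hx', fun hi ↦ hcon (.inl hi)⟩ hx
    · exact .inr hx'
  obtain ⟨x, hx, hxU⟩ := h
  refine (hC.subset_left_of_subset_union isOpen_interior isClosed_closure.isOpen_compl ?_ hcover
    ⟨x, hx, ?_⟩).trans interior_subset
  · exact disjoint_compl_right.mono_left (interior_subset.trans subset_closure)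
  · exact (hcover hx).resolve_right fun hcon ↦ hcon (subset_closure hxU)

theorem ncard_components {K : Set (ℝ × ℝ)} {ι : Type*} {B U : ι → Set (ℝ × ℝ)}
    (hB : ∀ i, IsPreconnected (K ∩ B i)) (hne : ∀ i, (K ∩ B i).Nonempty) (hBU : ∀ i, B i ⊆ U i)
    (hU : ∀ i, Disjoint (frontier (U i)) K) (hdisj : Pairwise fun i j ↦ Disjoint (U i) (U j))
    (h : ∀ p ∈ K, ∃ i, (connectedComponentIn K p ∩ B i).Nonempty) :
    (components K).ncard = Nat.card ι := by
  choose q hq using hne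
  have hsub (i : ι) : connectedComponentIn K (q i) ⊆ U i :=
    isPreconnected_connectedComponentIn.subset_of_disjoint_frontier
      ((hU i).mono_right (connectedComponentIn_subset _ _))
      ⟨q i, mem_connectedComponentIn (hq i).1, hBU i (hq i).2⟩
  have hinj : Function.Injective fun i ↦ connectedComponentIn K (q i) := fun i j hij ↦ by
    by_contra hne
    have hm := mem_connectedComponentIn (hq i).1
    exact (hdisj hne).notMem_of_mem_left (hsub i hm) (hsub j (hij.subset hm))
  have hrange : components K = range fun i ↦ connectedComponentIn K (q i) := by
    ext C
    constructor
    · rintro ⟨p, hp, rfl⟩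
      obtain ⟨i, z, hz, hzB⟩ := h p hp
      refine ⟨i, ?_⟩
      rw [connectedComponentIn_eq hz]
      exact connectedComponentIn_eq ((hB i).subset_connectedComponentIn (hq i) inter_subset_left
        ⟨connectedComponentIn_subset _ _ hz, hzB⟩)
    · rintro ⟨i, rfl⟩
      exact ⟨q i, (hq i).1, rfl⟩
  rw [hrange, ← image_univ, ncard_image_of_injective _ hinj, ncard_univ]

theorem ncard_components_image (e : ℝ × ℝ ≃ₜ ℝ × ℝ) (K : Set (ℝ × ℝ)) :
    (components (e '' K)).ncard = (components K).ncard := by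
  rw [← ncard_image_of_injective (components K) e.injective.image_injective]
  congr 1
  ext C
  constructor
  · rintro ⟨_, ⟨p, hp, rfl⟩, rfl⟩
    exact ⟨_, ⟨p, hp, rfl⟩, e.image_connectedComponentIn hp⟩
  · rintro ⟨_, ⟨p, hp, rfl⟩, rfl⟩
    exact ⟨e p, mem_image_of_mem e hp, e.image_connectedComponentIn hp⟩

end Topology

theorem Box.toSet_eq (b : Box) :
    b.toSet = Set.Icc (b.x - b.r : ℝ) (b.x + b.r) ×ˢ Set.Icc (b.y - b.s : ℝ) (b.y + b.s) := by
  ext p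
  simp only [Box.toSet, Set.mem_ofPred_eq, Set.mem_prod, Set.mem_Icc, abs_le, neg_le_sub_iff_le_add,
    sub_le_iff_le_add, add_comm]

theorem Box.disjoint_toSet {b c : Box}
    (h : b.r + c.r < (b.x - c.x).natAbs ∨ b.s + c.s < (b.y - c.y).natAbs) :
    Disjoint b.toSet c.toSet := by
  refine Set.disjoint_left.2 fun p hb hc ↦ ?_
  have h₁ := abs_sub_le (b.x : ℝ) p.1 c.x
  have h₂ := abs_sub_le (b.y : ℝ) p.2 c.y
  rw [abs_sub_comm _ p.1] at h₁
  rw [abs_sub_comm _ p.2] at h₂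
  rcases h with h | h <;> rw [← @Nat.cast_lt ℝ] at h <;>
    simp only [Nat.cast_add, Nat.cast_natAbs, Int.cast_abs, Int.cast_sub] at h
  · linarith [hb.1, hc.1]
  · linarith [hb.2, hc.2]

def zeros (P : BiPoly) : Set (ℝ × ℝ) := {p | eval p.1 p.2 P = 0}

theorem isClosed_zeros (P : BiPoly) : IsClosed (zeros P) :=
  isClosed_eq (continuous_eval P) continuous_const

theorem existsUnique_zero_of_peakTest {P : BiPoly} {b : Box} (h : peakTest P b = true) {y : ℝ}
    (hy : y ∈ Set.Icc (b.y - b.s : ℝ) (b.y + b.s)) :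
    ∃! x, x ∈ Set.Icc (b.x - b.r : ℝ) (b.x + b.r) ∧ eval x y P = 0 := by
  simp only [peakTest, Bool.and_eq_true] at h
  obtain ⟨⟨hl, hr⟩, hd⟩ := h
  have hy' : |y - b.y| ≤ b.s := abs_le.2 ⟨by linarith [hy.1], by linarith [hy.2]⟩
  have hpos := eval_pos_of_holdsOn hl (p := (b.x - b.r, y)) ⟨by simp [Box.left], hy'⟩
  have hneg := eval_neg_of_holdsOn hr (p := (b.x + b.r, y)) ⟨by simp [Box.right], hy'⟩
  refine existsUnique_zero_of_deriv_neg (by linarith [(b.r.cast_nonneg : (0 : ℝ) ≤ b.r)])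
    (fun x _ ↦ hasDerivAt_eval_fst P x y) (fun x hx ↦ ?_) hpos.le hneg.le
  exact eval_neg_of_holdsOn hd (p := (x, y))
    ⟨abs_le.2 ⟨by linarith [hx.1], by linarith [hx.2]⟩, hy'⟩

theorem isPreconnected_zeros_inter_of_peakTest {P : BiPoly} {b : Box} (h : peakTest P b = true) :
    IsPreconnected (zeros P ∩ b.toSet) := by
  rw [Box.toSet_eq]
  exact isPreconnected_zeros_of_existsUnique_fst (continuous_eval P) fun y hy ↦
    existsUnique_zero_of_peakTest h hy

theorem zeros_inter_nonempty_of_peakTest {P : BiPoly} {b : Box} (h : peakTest P b = true) :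
    (zeros P ∩ b.toSet).Nonempty := by
  obtain ⟨x, hx, h₀⟩ := (existsUnique_zero_of_peakTest h (y := b.y) (by simp)).exists
  refine ⟨(x, b.y), h₀, ?_⟩
  rw [Box.toSet_eq]
  exact ⟨hx, by simp⟩

theorem disjoint_frontier_zeros_of_fenceTest {P : BiPoly} {b : Box} (h : fenceTest P b = true) :
    Disjoint (frontier b.toSet) (zeros P) := by
  simp only [fenceTest, Bool.and_eq_true] at h
  obtain ⟨⟨⟨hl, hr⟩, hb⟩, ht⟩ := h
  refine Set.disjoint_left.2 fun p hp h₀ ↦ ?_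
  have hmem : p ∈ b.toSet := by
    refine IsClosed.frontier_subset ?_ hp
    rw [Box.toSet_eq]
    exact isClosed_Icc.prod isClosed_Icc
  rw [Box.toSet_eq, frontier_prod_eq, frontier_Icc (by linarith [(b.r.cast_nonneg : (0 : ℝ) ≤ b.r)]),
    frontier_Icc (by linarith [(b.s.cast_nonneg : (0 : ℝ) ≤ b.s)])] at hp
  rcases hp with ⟨-, hp | hp⟩ | ⟨hp | hp, -⟩
  · exact (eval_neg_of_holdsOn hb ⟨hmem.1, by simp [Box.bottom, hp]⟩).ne h₀
  · exact (eval_neg_of_holdsOn ht ⟨hmem.1, by simp [Box.top, Set.mem_singleton_iff.1 hp]⟩).ne h₀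
  · exact (eval_neg_of_holdsOn hl ⟨by simp [Box.left, hp], hmem.2⟩).ne h₀
  · exact (eval_neg_of_holdsOn hr ⟨by simp [Box.right, Set.mem_singleton_iff.1 hp], hmem.2⟩).ne h₀

theorem not_canMoveRight_of_noPeakTest {l : List Box} {P : BiPoly} {b : Box}
    (h : holdsOn (noPeakTest l) P b = true) {p : ℝ × ℝ} (hp : p ∈ b.toSet) (h₀ : p ∈ zeros P)
    (hmove : ¬ CanMoveRight (zeros P) p) : ∃ c ∈ l, p ∈ c.toSet := by
  have hY : eval p.1 p.2 (derivY P) = 0 := by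
    by_contra hne
    exact hmove (canMoveRight_of_deriv_snd_ne_zero (continuous_eval P) (continuous_eval (derivY P))
      (hasDerivAt_eval_snd P) h₀ hne)
  refine of_noPeakTest h hp h₀ hY fun ⟨hX, hYY⟩ ↦ hmove ?_
  exact canMoveRight_of_deriv_fst_pos (gy := fun p ↦ eval p.1 p.2 (derivY P)) (continuous_eval P) (continuous_eval (derivX P))
    (continuous_eval (derivY (derivY P))) (hasDerivAt_eval_fst P) (hasDerivAt_eval_snd P)
    (hasDerivAt_eval_snd (derivY P)) h₀ hY hX hYY

theorem isCompact_zeros {P : BiPoly} {b : Box} (hP : zeros P ⊆ b.toSet) : IsCompact (zeros P) := by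
  refine IsCompact.of_isClosed_subset ?_ (isClosed_zeros P) hP
  rw [Box.toSet_eq]
  exact isCompact_Icc.prod isCompact_Icc

theorem ncard_components_zeros {P : BiPoly} {b : Box} {l : List (Box × Box)}
    (hP : zeros P ⊆ b.toSet) (hpeak : ∀ o ∈ l, peakTest P o.1 = true)
    (hfence : ∀ o ∈ l, fenceTest P o.2 = true) (hle : ∀ o ∈ l, o.1.le o.2 = true)
    (hdisj : l.Pairwise fun o o' ↦
      o.2.r + o'.2.r < (o.2.x - o'.2.x).natAbs ∨ o.2.s + o'.2.s < (o.2.y - o'.2.y).natAbs)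
    (hnoPeak : holdsOn (noPeakTest (l.map Prod.fst)) P b = true) :
    (components (zeros P)).ncard = l.length := by
  have hdisj' : ∀ i j : Fin l.length, i < j → Disjoint (l.get i).2.toSet (l.get j).2.toSet :=
    fun i j hij ↦ Box.disjoint_toSet (List.pairwise_iff_get.1 hdisj i j hij)
  rw [ncard_components (B := fun i : Fin l.length ↦ (l.get i).1.toSet)
    (U := fun i ↦ (l.get i).2.toSet)
    (fun i ↦ isPreconnected_zeros_inter_of_peakTest (hpeak _ (l.get_mem i)))
    (fun i ↦ zeros_inter_nonempty_of_peakTest (hpeak _ (l.get_mem i)))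
    (fun i ↦ Box.toSet_subset_of_le (hle _ (l.get_mem i)))
    (fun i ↦ disjoint_frontier_zeros_of_fenceTest (hfence _ (l.get_mem i)))
    (fun i j hij ↦ hij.lt_or_gt.elim (hdisj' i j) fun h ↦ (hdisj' j i h).symm) ?_, Nat.card_fin]
  intro p hp
  obtain ⟨q, hq, hmove⟩ := exists_mem_connectedComponentIn_not_canMoveRight (isCompact_zeros hP) hp
  have hqP := connectedComponentIn_subset _ _ hq
  obtain ⟨c, hc, hqc⟩ := not_canMoveRight_of_noPeakTest hnoPeak (hP hqP) hqP hmove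
  obtain ⟨o, ho, rfl⟩ := List.mem_map.1 hc
  obtain ⟨i, rfl⟩ := List.get_of_mem ho
  exact ⟨i, q, hq, hqc⟩

/-- The homogenisation of `8 * Hess f`, in the coordinates `u = y - x`, `v = x + y`. -/
def hessForm (w u v : ℝ) : ℝ :=
  -776 * w ^ 6 - 1104 * w ^ 5 * v + 15216 * w ^ 4 * v ^ 2 + 33556 * w ^ 3 * v ^ 3
    - 12204 * w ^ 2 * v ^ 4 - 44160 * w * v ^ 5 - 18623 * v ^ 6
    + u * (16656 * w ^ 5 + 25824 * w ^ 4 * v - 37476 * w ^ 3 * v ^ 2 - 56124 * w ^ 2 * v ^ 3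
      - 140532 * w * v ^ 4 - 43380 * v ^ 5)
    + u ^ 2 * (-94560 * w ^ 4 - 126180 * w ^ 3 * v + 130140 * w ^ 2 * v ^ 2 + 164544 * w * v ^ 3
      - 404631 * v ^ 4)
    + u ^ 3 * (37716 * w ^ 3 + 26028 * w ^ 2 * v + 149112 * w * v ^ 2 + 141504 * v ^ 3)
    + u ^ 4 * (134136 * w ^ 2 + 57888 * w * v + 170307 * v ^ 2)
    + u ^ 5 * (-34020 * w - 27756 * v) - 60813 * u ^ 6

theorem hessForm_mul (t w u v : ℝ) : hessForm (t * w) (t * u) (t * v) = t ^ 6 * hessForm w u v := by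
  unfold hessForm
  ring

theorem eval_affineChart (N : ℤ) (u v : ℝ) : eval u v (affineChart N) = hessForm N u v := by
  simp only [affineChart, BiPoly.eval, UniPoly.eval, hessForm]
  push_cast
  ring

theorem eval_firstChartAtInfinity (N : ℤ) (w v : ℝ) :
    eval w v (firstChartAtInfinity N) = hessForm w N v := by
  simp only [firstChartAtInfinity, BiPoly.eval, UniPoly.eval, hessForm]
  push_cast
  ring

theorem eval_secondChartAtInfinity (N : ℤ) (w u : ℝ) :
    eval w u (secondChartAtInfinity N) = hessForm w u N := by
  simp only [secondChartAtInfinity, BiPoly.eval, UniPoly.eval, hessForm]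
  push_cast
  ring

theorem eval_hess_f (x y : ℝ) :
    8 * MvPolynomial.eval ![x, y] (Hess f) = hessForm 1 (y - x) (x + y) := by
  have hC (i : Fin 2) (n : ℕ) [n.AtLeastTwo] :
      pderiv i (OfNat.ofNat n : MvPolynomial (Fin 2) ℝ) = 0 :=
    Derivation.map_natCast _ n
  have h₀ : pderiv 0 (X 1 : MvPolynomial (Fin 2) ℝ) = 0 := pderiv_X_of_ne (by decide)
  have h₁ : pderiv 1 (X 0 : MvPolynomial (Fin 2) ℝ) = 0 := pderiv_X_of_ne (by decide)
  simp only [Hess, f, hessForm, map_add, map_sub, pderiv_mul, pderiv_pow, pderiv_X_self, h₀, h₁,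
    hC, map_zero, map_one, map_mul, map_pow, map_natCast, map_ofNat, MvPolynomial.eval_X,
    Matrix.cons_val_zero, Matrix.cons_val_one, mul_zero, zero_mul, add_zero, zero_add, sub_zero,
    pderiv_one, mul_one, Nat.cast_ofNat, Nat.add_one_sub_one, Matrix.cons_val_fin_one]
  ring

theorem hessForm_neg {w u v : ℝ} (h : 4 * |w| < max |u| |v|) : hessForm w u v < 0 := by
  have key {t : ℝ} (ht : t ≠ 0) (h : hessForm (16 / t * w) (16 / t * u) (16 / t * v) < 0) :
      hessForm w u v < 0 := by
    rw [hessForm_mul] at h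
    exact neg_of_mul_neg_right h (by positivity)
  have scale {s t : ℝ} (ht : t ≠ 0) {c : ℝ} (h : c * |s| ≤ |t|) : c * |16 / t * s| ≤ 16 := by
    rw [abs_mul, abs_div, div_mul_eq_mul_div, mul_div_assoc', div_le_iff₀ (abs_pos.2 ht)]
    norm_num
    linarith
  rcases le_total |v| |u| with hvu | hvu
  · rw [max_eq_left hvu] at h
    have hu : u ≠ 0 := by
      rintro rfl
      linarith [abs_nonneg w, abs_zero (α := ℝ)]
    refine key hu ?_
    have := eval_neg_of_holdsOn holdsOn_firstChartAtInfinity (p := (16 / u * w, 16 / u * v))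
      ⟨by simpa using (by linarith [scale hu h.le] : |16 / u * w| ≤ 4),
        by simpa using scale hu (c := 1) (by simpa using hvu)⟩
    rw [eval_firstChartAtInfinity] at this
    simpa [hu] using this
  · rw [max_eq_right hvu] at h
    have hv : v ≠ 0 := by
      rintro rfl
      linarith [abs_nonneg w, abs_zero (α := ℝ)]
    refine key hv ?_
    have := eval_neg_of_holdsOn holdsOn_secondChartAtInfinity (p := (16 / v * w, 16 / v * u))
      ⟨by simpa using (by linarith [scale hv h.le] : |16 / v * w| ≤ 4),
        by simpa using scale hv (c := 1) (by simpa using hvu)⟩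
    rw [eval_secondChartAtInfinity] at this
    simpa [hv] using this

theorem zeros_affineChart_subset :
    zeros (affineChart 1024) ⊆ (⟨0, 0, 4096, 4096⟩ : Box).toSet := by
  intro p hp
  have h : max |p.1| |p.2| ≤ 4096 := by
    by_contra! hlt
    refine (hessForm_neg (w := (1024 : ℤ)) (u := p.1) (v := p.2) ?_).ne ?_
    · norm_num
      norm_num at hlt
      exact hlt
    · rw [← eval_affineChart]
      exact hp
  simpa [Box.toSet] using h

/-- The inverse of `(x, y) ↦ (1024 * (y - x), 1024 * (x + y))`. -/
def unscale : ℝ × ℝ ≃ₜ ℝ × ℝ where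
  toFun p := ((p.2 - p.1) / 2048, (p.1 + p.2) / 2048)
  invFun p := (1024 * (p.2 - p.1), 1024 * (p.1 + p.2))
  left_inv p := by ext <;> ring
  right_inv p := by ext <;> ring

theorem image_zeros_affineChart : unscale '' zeros (affineChart 1024) = Z := by
  rw [unscale.image_eq_preimage_symm]
  ext ⟨x, y⟩
  change eval (1024 * (y - x)) (1024 * (x + y)) (affineChart 1024) = 0 ↔
    MvPolynomial.eval ![x, y] (Hess f) = 0
  have h := hessForm_mul 1024 1 (y - x) (x + y)
  rw [← eval_hess_f, mul_one] at h
  rw [eval_affineChart]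
  push_cast
  rw [h]
  simp

end

end HessianCurve

/-- The hessian curve of `f` is compact and has exactly 8 connected components. -/
theorem hessian_curve_components :
    IsCompact Z ∧ (components Z).ncard = 8 := by
  rw [← HessianCurve.image_zeros_affineChart, HessianCurve.ncard_components_image]
  exact ⟨(HessianCurve.isCompact_zeros HessianCurve.zeros_affineChart_subset).image
      HessianCurve.unscale.continuous,
    HessianCurve.ncard_components_zeros HessianCurve.zeros_affineChart_subset
      HessianCurve.peakTest_ovals HessianCurve.fenceTest_ovals HessianCurve.le_ovals
      HessianCurve.pairwise_ovals HessianCurve.noPeakTest_ovals⟩
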